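/- Let μ be a probability measure on ℝ whose characteristic function f admits a Lévy–Khintchine-type representation with a signed spectral measure: there exist γ ∈ ℝ and finite (nonnegative) Borel measures G₁, G₂ on ℝ such that f(t) = exp( itγ + ∫_ℝ K(t,x) dG₁(x) − ∫_ℝ K(t,x) dG₂(x) ) for all t ∈ ℝ, where K(t,x) = (exp(itx) − 1 − i·t·sin(x))·(1+x²)/x² for x ≠ 0 and K(t,0) = −t²/2. Then μ is rational-infinitely divisible: there exist infinitely divisible probability measures μ₁, μ₂ on ℝ with μ₁ = μ ∗ μ₂. -/

import Mathlib

open MeasureTheory Complex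

/-- The characteristic function of a measure `μ` on `ℝ`:
`f(t) = ∫ exp(itx) dμ(x)`. -/
noncomputable def charFn (μ : Measure ℝ) (t : ℝ) : ℂ :=
  ∫ x : ℝ, Complex.exp (t * x * Complex.I) ∂μ

/-- `n`-fold (additive) convolution power of a measure on `ℝ`. -/
noncomputable def convPow (ρ : Measure ℝ) : ℕ → Measure ℝ
  | 0 => Measure.dirac 0
  | n + 1 => Measure.conv (convPow ρ n) ρ

/-- A probability measure `ν` on `ℝ` is infinitely divisible if for every `n ≥ 1`
there is a probability measure `ρ` with `ν = ρ^{*n}`. -/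
def IsInfinitelyDivisible (ν : Measure ℝ) : Prop :=
  IsProbabilityMeasure ν ∧
    ∀ n : ℕ, 0 < n → ∃ ρ : Measure ℝ, IsProbabilityMeasure ρ ∧ ν = convPow ρ n

/-- A probability measure `μ` on `ℝ` is rational-infinitely divisible if there are
infinitely divisible probability measures `μ₁, μ₂` with `μ₁ = μ ∗ μ₂`. -/
def IsRationalInfinitelyDivisible (μ : Measure ℝ) : Prop :=
  ∃ μ₁ μ₂ : Measure ℝ, IsInfinitelyDivisible μ₁ ∧ IsInfinitelyDivisible μ₂ ∧
    μ₁ = Measure.conv μ μ₂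

/-- The Lévy–Khintchine-type kernel
`K(t,x) = (exp(itx) − 1 − i·t·sin(x))·(1+x²)/x²` for `x ≠ 0`, with `K(t,0) = −t²/2`. -/
noncomputable def lkKernel (t x : ℝ) : ℂ :=
  if x = 0 then -(t ^ 2) / 2
  else (Complex.exp (t * x * Complex.I) - 1 - Complex.I * t * Real.sin x) *
    ((1 + x ^ 2) / x ^ 2)

open Filter Topology in
/-- A pointwise limit of characteristic functions that is continuous at `0` is itself the
characteristic function of a probability measure. -/
lemma exists_charFun_eq_of_tendsto {f : ℕ → ℝ → ℂ} {g : ℝ → ℂ}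
    (hf : ∀ n, ∃ ρ : Measure ℝ, IsProbabilityMeasure ρ ∧ charFun ρ = f n)
    (hg : ContinuousAt g 0) (hlim : ∀ t, Tendsto (fun n ↦ f n t) atTop (𝓝 (g t))) :
    ∃ ρ : Measure ℝ, IsProbabilityMeasure ρ ∧ charFun ρ = g := by
  choose ρ hρ hρf using hf
  have htight : IsTightMeasureSet (Set.range ρ) :=
    isTightMeasureSet_of_tendsto_charFun hg fun t ↦ by simpa only [hρf] using hlim t
  let P : ℕ → ProbabilityMeasure ℝ := fun n ↦ ⟨ρ n, hρ n⟩
  have hcompact : IsCompact (closure (Set.range P)) := by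
    refine isCompact_closure_of_isTightMeasureSet (htight.subset ?_)
    rintro _ ⟨_, ⟨n, rfl⟩, rfl⟩
    exact ⟨n, rfl⟩
  obtain ⟨Q, -, φ, hφ, hQ⟩ :=
    hcompact.tendsto_subseq fun n ↦ subset_closure (Set.mem_range_self n)
  refine ⟨Q, inferInstance, funext fun t ↦ ?_⟩
  have h₁ := ProbabilityMeasure.tendsto_iff_tendsto_charFun.1 hQ t
  refine tendsto_nhds_unique h₁ (((hlim t).comp hφ.tendsto_atTop).congr fun n ↦ ?_)
  simp only [Function.comp_apply, ← hρf]
  rfl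

/-- A product of characteristic functions of probability measures is a characteristic function. -/
lemma exists_charFun_eq_mul {f g : ℝ → ℂ}
    (hf : ∃ ρ : Measure ℝ, IsProbabilityMeasure ρ ∧ charFun ρ = f)
    (hg : ∃ ρ : Measure ℝ, IsProbabilityMeasure ρ ∧ charFun ρ = g) :
    ∃ ρ : Measure ℝ, IsProbabilityMeasure ρ ∧ charFun ρ = fun t ↦ f t * g t := by
  obtain ⟨ρ, hρ, rfl⟩ := hf
  obtain ⟨σ, hσ, rfl⟩ := hg
  exact ⟨ρ.conv σ, inferInstance, funext fun t ↦ charFun_conv t⟩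

lemma charFn_eq_charFun (μ : Measure ℝ) : charFn μ = charFun μ := by
  ext t
  rw [charFun_apply_real, charFn]

lemma isProbabilityMeasure_convPow (ρ : Measure ℝ) [IsProbabilityMeasure ρ] (n : ℕ) :
    IsProbabilityMeasure (convPow ρ n) := by
  induction n with
  | zero => exact Measure.dirac.isProbabilityMeasure
  | succ n ih => exact Measure.probabilitymeasure_of_probabilitymeasures_conv _ _

lemma charFun_convPow (ρ : Measure ℝ) [IsProbabilityMeasure ρ] (n : ℕ) (t : ℝ) :
    charFun (convPow ρ n) t = charFun ρ t ^ n := by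
  induction n with
  | zero => simp [convPow, charFun_dirac]
  | succ n ih =>
    have := isProbabilityMeasure_convPow ρ n
    rw [convPow, charFun_conv, ih, pow_succ]

lemma integrable_exp_mul_I (ν : Measure ℝ) [IsFiniteMeasure ν] (t : ℝ) :
    Integrable (fun x : ℝ ↦ cexp (t * x * I)) ν := by
  refine Integrable.of_bound (by fun_prop) 1 (.of_forall fun x ↦ ?_)
  rw [← ofReal_mul, norm_exp_ofReal_mul_I]

/-- The mixture of a point mass at `0` and a finite measure of total mass at most `r`, rescaled by
`r`, has the expected characteristic function. -/
lemma exists_charFun_eq_one_add_div (ν : Measure ℝ) [IsFiniteMeasure ν] {r : ℝ} (hr : 0 < r)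
    (hν : ν.real Set.univ ≤ r) :
    ∃ ρ : Measure ℝ, IsProbabilityMeasure ρ ∧
      charFun ρ = fun t ↦ 1 + (charFun ν t - ν.real Set.univ) / r := by
  have h₀ : 0 ≤ 1 - ν.real Set.univ / r := by
    rw [sub_nonneg]
    exact (div_le_one hr).2 hν
  obtain ⟨a, ha⟩ : ∃ a : NNReal, (a : ℝ) = 1 - ν.real Set.univ / r := ⟨⟨_, h₀⟩, rfl⟩
  obtain ⟨b, hb⟩ : ∃ b : NNReal, (b : ℝ) = r⁻¹ := ⟨⟨_, inv_nonneg.2 hr.le⟩, rfl⟩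
  refine ⟨a • Measure.dirac 0 + b • ν, ⟨?_⟩, funext fun t ↦ ?_⟩
  · have h : (a • Measure.dirac (0 : ℝ) + b • ν).real Set.univ = 1 := by
      rw [measureReal_add_apply, measureReal_nnreal_smul_apply, measureReal_nnreal_smul_apply,
        probReal_univ, ha, hb]
      ring
    rw [← ENNReal.toReal_eq_one_iff]
    exact h
  · rw [charFun_apply_real, integral_add_measure
      (Integrable.smul_measure_nnreal (integrable_exp_mul_I _ t))
      (Integrable.smul_measure_nnreal (integrable_exp_mul_I _ t)),
      integral_smul_nnreal_measure, integral_smul_nnreal_measure, integral_dirac,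
      ← charFun_apply_real]
    simp only [NNReal.smul_def, ha, hb, real_smul]
    push_cast
    simp
    ring

open Filter Topology in
/-- Existence of compound Poisson distributions. -/
lemma exists_charFun_eq_exp_charFun_sub (ν : Measure ℝ) [IsFiniteMeasure ν] :
    ∃ ρ : Measure ℝ, IsProbabilityMeasure ρ ∧
      charFun ρ = fun t ↦ cexp (charFun ν t - ν.real Set.univ) := by
  obtain ⟨N, hN⟩ := exists_nat_ge (ν.real Set.univ)
  refine exists_charFun_eq_of_tendsto
    (f := fun n t ↦ (1 + (charFun ν t - ν.real Set.univ) / ((n + (N + 1) : ℕ) : ℂ)) ^ (n + (N + 1)))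
    (fun n ↦ ?_) (by have := continuous_charFun (μ := ν); fun_prop) fun t ↦
      (tendsto_add_atTop_iff_nat (f := fun n : ℕ ↦
        (1 + (charFun ν t - ν.real Set.univ) / (n : ℂ)) ^ n) (N + 1)).2
        (Complex.tendsto_one_add_div_pow_exp _)
  obtain ⟨ρ, hρ, h⟩ := exists_charFun_eq_one_add_div ν (r := (n + (N + 1) : ℕ))
    (by positivity) (by push_cast; linarith [(n.cast_nonneg : (0 : ℝ) ≤ n)])
  refine ⟨convPow ρ (n + (N + 1)), isProbabilityMeasure_convPow _ _, funext fun t ↦ ?_⟩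
  rw [charFun_convPow, h]
  push_cast
  rfl

lemma norm_exp_mul_I_sub_one_sub_le (y : ℝ) : ‖cexp (y * I) - 1 - y * I‖ ≤ 3 * y ^ 2 := by
  have hy : ‖(y * I : ℂ)‖ = |y| := by simp
  rcases le_total |y| 1 with h | h
  · have := Complex.norm_exp_sub_one_sub_id_le (hy.trans_le h)
    rw [hy, sq_abs] at this
    nlinarith [sq_nonneg y]
  · calc ‖cexp (y * I) - 1 - y * I‖ ≤ ‖cexp (y * I)‖ + ‖(1 : ℂ)‖ + ‖(y * I : ℂ)‖ :=
          (norm_sub_le _ _).trans (by gcongr; exact norm_sub_le _ _)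
      _ = 1 + 1 + |y| := by rw [norm_exp_ofReal_mul_I, hy, norm_one]
      _ ≤ 3 * y ^ 2 := by rw [← sq_abs]; nlinarith

lemma norm_lkKernel_le (t x : ℝ) : ‖lkKernel t x‖ ≤ 2 * (3 * t ^ 2 + |t| + 2) := by
  have ht := abs_nonneg t
  unfold lkKernel
  split_ifs with hx
  · have : (-(t ^ 2) / 2 : ℂ) = ((-(t ^ 2) / 2 : ℝ) : ℂ) := by push_cast; rfl
    rw [this, norm_real, Real.norm_eq_abs, abs_le]
    constructor <;> nlinarith [sq_nonneg t]
  · have hfac : ((1 + x ^ 2) / x ^ 2 : ℂ) = ((1 + x ^ 2) / x ^ 2 : ℝ) := by push_cast; rfl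
    have hx2 : 0 < x ^ 2 := by positivity
    rw [norm_mul, hfac, norm_real, Real.norm_of_nonneg (by positivity), ← mul_div_assoc,
      div_le_iff₀ hx2]
    rcases le_total |x| 1 with h | h
    · have hnum : ‖cexp (t * x * I) - 1 - I * t * Real.sin x‖ ≤ (3 * t ^ 2 + |t|) * x ^ 2 := by
        have hsplit : cexp (t * x * I) - 1 - I * t * Real.sin x
            = (cexp ((t * x : ℝ) * I) - 1 - (t * x : ℝ) * I)
              + I * ((t * (x - Real.sin x) : ℝ) : ℂ) := by
          push_cast; ring
        rw [hsplit]
        refine (norm_add_le _ _).trans ?_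
        have h₁ := norm_exp_mul_I_sub_one_sub_le (t * x)
        have h₂ : ‖I * ((t * (x - Real.sin x) : ℝ) : ℂ)‖ ≤ |t| * x ^ 2 := by
          rw [norm_mul, norm_I, one_mul, norm_real, Real.norm_eq_abs, abs_mul]
          gcongr
          refine (Real.abs_sub_sin_le x).trans ?_
          rw [← sq_abs x]
          nlinarith [sq_nonneg |x|, abs_nonneg x]
        linarith [mul_pow t x 2]
      have hx1 : x ^ 2 ≤ 1 := by rw [← sq_abs]; exact pow_le_one₀ (abs_nonneg x) h
      calc _ ≤ (3 * t ^ 2 + |t|) * x ^ 2 * 2 := by gcongr; linarith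
        _ ≤ _ := by nlinarith
    · have hnum : ‖cexp (t * x * I) - 1 - I * t * Real.sin x‖ ≤ 2 + |t| := by
        have h₁ : ‖cexp (t * x * I)‖ = 1 := by rw [← ofReal_mul, norm_exp_ofReal_mul_I]
        have h₂ : ‖I * t * Real.sin x‖ ≤ |t| := by
          rw [norm_mul, norm_mul, norm_I, one_mul, norm_real, norm_real, Real.norm_eq_abs,
            Real.norm_eq_abs]
          exact mul_le_of_le_one_right ht (Real.abs_sin_le_one x)
        have h₃ := norm_sub_le (cexp (t * x * I) - 1) (I * t * Real.sin x)
        have h₄ := norm_sub_le (cexp (t * x * I)) 1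
        rw [norm_one] at h₄
        linarith
      have hx1 : 1 ≤ x ^ 2 := by rw [← sq_abs]; exact one_le_pow₀ h
      calc _ ≤ (2 + |t|) * (2 * x ^ 2) := by gcongr; linarith
        _ ≤ _ := by nlinarith [mul_nonneg (sq_nonneg t) hx2.le]

lemma measurable_lkKernel (t : ℝ) : Measurable (lkKernel t) :=
  Measurable.ite (measurableSet_singleton 0) measurable_const (by fun_prop)

lemma integrable_lkKernel (G : Measure ℝ) [IsFiniteMeasure G] (t : ℝ) :
    Integrable (lkKernel t) G :=
  .of_bound (measurable_lkKernel t).aestronglyMeasurable _ (.of_forall (norm_lkKernel_le t))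

lemma continuousAt_integral_lkKernel (G : Measure ℝ) [IsFiniteMeasure G] :
    ContinuousAt (fun t ↦ ∫ x, lkKernel t x ∂G) 0 := by
  refine continuousAt_of_dominated (bound := fun _ ↦ 12)
    (.of_forall fun t ↦ (measurable_lkKernel t).aestronglyMeasurable) ?_ (integrable_const _)
    (.of_forall fun x ↦ ?_)
  · filter_upwards [Metric.ball_mem_nhds (0 : ℝ) one_pos] with t ht
    have ht' : |t| ≤ 1 := by simpa using (Metric.mem_ball.1 ht).le
    refine .of_forall fun x ↦ (norm_lkKernel_le t x).trans ?_
    nlinarith [sq_abs t, abs_nonneg t]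
  · unfold lkKernel
    split_ifs <;> fun_prop

/-- The part of the Lévy–Khintchine formula coming from jumps bounded away from `0`. -/
lemma exists_charFun_eq_exp_setIntegral_lkKernel (G : Measure ℝ) [IsFiniteMeasure G] {ε : ℝ}
    (hε : 0 < ε) :
    ∃ ρ : Measure ℝ, IsProbabilityMeasure ρ ∧
      charFun ρ = fun t ↦ cexp (∫ x in {x | ε < |x|}, lkKernel t x ∂G) := by
  set s : Set ℝ := {x | ε < |x|} with hs
  have hsm : MeasurableSet s := measurableSet_lt measurable_const (by fun_prop)
  have hs0 : ∀ x ∈ s, x ≠ 0 := by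
    rintro x hx rfl
    simp only [hs, Set.mem_ofPred_eq, abs_zero] at hx
    linarith
  let d : ℝ → NNReal := fun x ↦ Real.toNNReal ((1 + x ^ 2) / x ^ 2)
  have hdm : Measurable d := by fun_prop
  have hd : ∀ x, (d x : ℝ) = (1 + x ^ 2) / x ^ 2 := fun x ↦
    Real.coe_toNNReal _ (by positivity)
  have hdint : Integrable (fun x ↦ (d x : ℝ)) (G.restrict s) := by
    refine Integrable.of_bound (by fun_prop) (1 / ε ^ 2 + 1) ?_
    filter_upwards [ae_restrict_mem hsm] with x hx
    have hx' : 0 < x ^ 2 := by have := hs0 x hx; positivity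
    have hxε : ε ^ 2 ≤ x ^ 2 := by
      rw [← sq_abs x]
      exact pow_le_pow_left₀ hε.le (le_of_lt hx) 2
    rw [Real.norm_of_nonneg (d x).coe_nonneg, hd, add_div, div_self hx'.ne']
    gcongr
  let ν : Measure ℝ := (G.restrict s).withDensity fun x ↦ d x
  have : IsFiniteMeasure ν := isFiniteMeasure_withDensity (by
    have := hdint.lintegral_lt_top
    simpa using this.ne)
  have hint (f : ℝ → ℂ) : ∫ x, f x ∂ν = ∫ x in s, f x * ((1 + x ^ 2) / x ^ 2) ∂G := by
    rw [integral_withDensity_eq_integral_smul hdm]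
    refine integral_congr_ae (.of_forall fun x ↦ ?_)
    simp only [NNReal.smul_def, hd, real_smul]
    push_cast
    ring
  have hsin : Integrable (fun x : ℝ ↦ (Real.sin x : ℂ)) ν :=
    .of_bound (by fun_prop) 1 (.of_forall fun x ↦ by
      rw [norm_real]; exact Real.abs_sin_le_one x)
  obtain ⟨ρ, hρ, h⟩ := exists_charFun_eq_mul (exists_charFun_eq_exp_charFun_sub ν)
    ⟨Measure.dirac (-∫ x, Real.sin x ∂ν), inferInstance, rfl⟩
  refine ⟨ρ, hρ, h.trans (funext fun t ↦ ?_)⟩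
  rw [charFun_dirac, ← Complex.exp_add]
  congr 1
  have hK : ∫ x in s, lkKernel t x ∂G
      = ∫ x, (cexp (t * x * I) - 1 - I * t * Real.sin x) ∂ν := by
    rw [hint]
    refine setIntegral_congr_fun hsm fun x hx ↦ ?_
    simp only [lkKernel, if_neg (hs0 x hx)]
  rw [hK, integral_sub (f := fun x : ℝ ↦ cexp (t * x * I) - 1)
      ((integrable_exp_mul_I ν t).sub (integrable_const _)) (hsin.const_mul _),
    integral_sub (integrable_exp_mul_I ν t) (integrable_const _), integral_const_mul,
    integral_complex_ofReal, ← charFun_apply_real]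
  simp
  ring

open Filter Topology in
/-- Existence part of the Lévy–Khintchine theorem. -/
lemma exists_charFun_eq_levyKhintchine (γ : ℝ) (G : Measure ℝ) [IsFiniteMeasure G] :
    ∃ ρ : Measure ℝ, IsProbabilityMeasure ρ ∧
      charFun ρ = fun t ↦ cexp (I * t * γ + ∫ x, lkKernel t x ∂G) := by
  let ε : ℕ → ℝ := fun n ↦ 1 / ((n : ℝ) + 1)
  have hεpos (n : ℕ) : 0 < ε n := Nat.one_div_pos_of_nat
  have hεlim : Tendsto ε atTop (𝓝 0) := tendsto_one_div_add_atTop_nhds_zero_nat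
  have hsm (n : ℕ) : MeasurableSet {x : ℝ | ε n < |x|} :=
    measurableSet_lt measurable_const (by fun_prop)
  let v : NNReal := (G {0}).toNNReal
  refine exists_charFun_eq_of_tendsto
    (f := fun n t ↦ cexp (∫ x in {x | ε n < |x|}, lkKernel t x ∂G) *
      cexp (t * γ * I - v * t ^ 2 / 2))
    (fun n ↦ exists_charFun_eq_mul (exists_charFun_eq_exp_setIntegral_lkKernel G (hεpos n))
      ⟨ProbabilityTheory.gaussianReal γ v, inferInstance,
        funext ProbabilityTheory.charFun_gaussianReal⟩)
    ?_ fun t ↦ ?_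
  · exact (ContinuousAt.add (by fun_prop) (continuousAt_integral_lkKernel G)).cexp
  · simp_rw [← Complex.exp_add]
    refine (Complex.continuous_exp.tendsto _).comp ?_
    have hlim : Tendsto (fun n ↦ ∫ x in {x | ε n < |x|}, lkKernel t x ∂G) atTop
        (𝓝 (∫ x in {0}ᶜ, lkKernel t x ∂G)) := by
      simp_rw [← integral_indicator (hsm _),
        ← integral_indicator (measurableSet_singleton (0 : ℝ)).compl]
      refine tendsto_integral_of_dominated_convergence (fun x ↦ ‖lkKernel t x‖)
        (fun n ↦ ((measurable_lkKernel t).indicator (hsm n)).aestronglyMeasurable)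
        (integrable_lkKernel G t).norm
        (fun n ↦ .of_forall fun x ↦ norm_indicator_le_norm_self _ _) (.of_forall fun x ↦ ?_)
      refine tendsto_const_nhds.congr' ?_
      by_cases hx : x = 0
      · subst hx
        refine .of_forall fun n ↦ ?_
        beta_reduce
        rw [Set.indicator_of_notMem (by simp), Set.indicator_of_notMem (by simp [(hεpos n).le])]
      · filter_upwards [hεlim.eventually (gt_mem_nhds (abs_pos.2 hx))] with n hn
        rw [Set.indicator_of_mem (by simpa using hx), Set.indicator_of_mem (by simpa using hn)]
    have hzero : ∫ x in {0}, lkKernel t x ∂G = -(v * t ^ 2 / 2) := by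
      rw [integral_singleton]
      simp only [lkKernel, if_true, real_smul]
      change ((v : ℝ) : ℂ) * _ = _
      ring
    convert hlim.add_const (t * γ * I - v * t ^ 2 / 2 : ℂ) using 2
    rw [← integral_add_compl (measurableSet_singleton 0) (integrable_lkKernel G t), hzero]
    ring

lemma isInfinitelyDivisible_of_charFun_eq {ν : Measure ℝ} [IsProbabilityMeasure ν] {γ : ℝ}
    {G : Measure ℝ} [IsFiniteMeasure G]
    (hν : charFun ν = fun t ↦ cexp (I * t * γ + ∫ x, lkKernel t x ∂G)) :
    IsInfinitelyDivisible ν := by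
  refine ⟨inferInstance, fun n hn ↦ ?_⟩
  obtain ⟨ρ, hρ, h⟩ := exists_charFun_eq_levyKhintchine (γ / n) ((n : NNReal)⁻¹ • G)
  have := isProbabilityMeasure_convPow ρ n
  refine ⟨ρ, hρ, Measure.ext_of_charFun (funext fun t ↦ ?_)⟩
  have hn' : (n : ℂ) ≠ 0 := by exact_mod_cast hn.ne'
  rw [charFun_convPow, h, hν]
  simp only
  rw [← Complex.exp_nat_mul, integral_smul_nnreal_measure, NNReal.smul_def, real_smul]
  congr 1
  push_cast
  field_simp

/-- If the characteristic function of a probability measure `μ` on `ℝ` admits a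
Lévy–Khintchine-type representation with a signed spectral measure `G₁ − G₂`
(where `G₁, G₂` are finite Borel measures) and shift `γ`, then `μ` is
rational-infinitely divisible. -/
theorem levyKhintchineType_imp_rid
    (μ : Measure ℝ) [IsProbabilityMeasure μ]
    (γ : ℝ) (G₁ G₂ : Measure ℝ) [IsFiniteMeasure G₁] [IsFiniteMeasure G₂]
    (hrepr : ∀ t : ℝ, charFn μ t =
      Complex.exp (Complex.I * t * γ + (∫ x : ℝ, lkKernel t x ∂G₁) -
        ∫ x : ℝ, lkKernel t x ∂G₂)) :
    IsRationalInfinitelyDivisible μ := by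
  obtain ⟨μ₁, hμ₁, h₁⟩ := exists_charFun_eq_levyKhintchine γ G₁
  obtain ⟨μ₂, hμ₂, h₂⟩ := exists_charFun_eq_levyKhintchine 0 G₂
  refine ⟨μ₁, μ₂, isInfinitelyDivisible_of_charFun_eq h₁, isInfinitelyDivisible_of_charFun_eq h₂,
    Measure.ext_of_charFun (funext fun t ↦ ?_)⟩
  rw [charFun_conv, ← charFn_eq_charFun μ, hrepr, h₁, h₂]
  simp only
  rw [← Complex.exp_add]
  congr 1
  push_cast
  ring
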